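/- Suppose Assumptions A1–A3 hold. For a pair C = (C_1, C_2) of positive integers define A_C = A_{1,C_1} ∩ A_{2,C} ⊆ F^ℕ, where A_{1,C_1} = {x ∈ F^ℕ : sup_{j ≥ C_1} ∏_{i=1}^j λ(x_i) ≤ 1 − 1/C_1 and b(x_1) + Σ_{i≥2} ∏_{k=1}^{i-1} λ(x_k) b(x_i) ≤ C_1} and A_{2,C} = {x ∈ F^ℕ : η(2C_1(2C_1+1), x_0) ≥ 1/(C_2+1)}, and set ξ_t = (X_{t-j})_{j≥0}. Then there exists a random pair C = (C_1, C_2) of positive integers such that for ℙ-almost all ω, lim_n (1/n) Σ_{i=0}^n 1_{A_{C(ω)}}(ξ_i(ω)) = lim_n (1/n) Σ_{i=1}^n 1_{A_{C(ω)}}(ξ_{-i}(ω)) = ρ_{C(ω)}(ω) > 0, where ρ_C = ℙ(ξ_0 ∈ A_C | X^{-1}(𝓘)) and 𝓘 is the σ-field of shift-invariant measurable subsets of F^ℤ. -/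

import Mathlib

open MeasureTheory ProbabilityTheory Filter
open scoped ENNReal

noncomputable section

/-- The shift operator on two-sided paths. -/
def zshift {α : Type*} (x : ℤ → α) : ℤ → α := fun t => x (t + 1)

/-- The σ-algebra of shift-invariant measurable subsets of `F^ℤ`. -/
def invSigma (F : Type*) [MeasurableSpace F] : MeasurableSpace (ℤ → F) where
  MeasurableSet' S := MeasurableSet S ∧ zshift ⁻¹' S = S
  measurableSet_empty := ⟨MeasurableSet.empty, rfl⟩
  measurableSet_compl S hS := ⟨hS.1.compl, by rw [Set.preimage_compl, hS.2]⟩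
  measurableSet_iUnion g hg := by
    refine ⟨MeasurableSet.iUnion fun i => (hg i).1, ?_⟩
    rw [Set.preimage_iUnion]
    exact Set.iUnion_congr fun i => (hg i).2

/-- The set `A_C = A_{1,C₁} ∩ A_{2,C}` of "good" one-sided environments, for a pair
`C = (C₁, C₂)` of positive integers. -/
def goodSet {F : Type*} (lam b : F → ℝ) (η : ℝ → F → ℝ) (C : ℕ × ℕ) : Set (ℕ → F) :=
  {x : ℕ → F |
    -- A_{1,C₁} : sup_{j ≥ C₁} ∏_{i=1}^j λ(x_i) ≤ 1 − 1/C₁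
    (∀ j : ℕ, C.1 ≤ j → ∏ i ∈ Finset.range j, lam (x (i + 1)) ≤ 1 - 1 / (C.1 : ℝ)) ∧
    -- A_{1,C₁} : b(x₁) + Σ_{i≥2} ∏_{k=1}^{i-1} λ(x_k) b(x_i) ≤ C₁
    ENNReal.ofReal (b (x 1)) +
        ∑' m : ℕ, (∏ k ∈ Finset.range (m + 1), ENNReal.ofReal (lam (x (k + 1)))) *
          ENNReal.ofReal (b (x (m + 2))) ≤ (C.1 : ℝ≥0∞) ∧
    -- A_{2,C} : η(2C₁(2C₁+1), x₀) ≥ 1/(C₂+1)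
    1 / ((C.2 : ℝ) + 1) ≤ η (2 * (C.1 : ℝ) * (2 * (C.1 : ℝ) + 1)) (x 0)}

/-- Running maxima of the Birkhoff sums. -/
def runMax {α : Type*} (T : α → α) (h : α → ℝ) : ℕ → α → ℝ
  | 0 => fun _ => 0
  | n + 1 => fun x => max 0 (h x + runMax T h n (T x))

lemma runMax_nonneg {α : Type*} (T : α → α) (h : α → ℝ) (n : ℕ) (x : α) :
    0 ≤ runMax T h n x := by
  cases n with
  | zero => exact le_rfl
  | succ n => exact le_max_left _ _

lemma runMax_mono {α : Type*} (T : α → α) (h : α → ℝ) (n : ℕ) :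
    ∀ x, runMax T h n x ≤ runMax T h (n + 1) x := by
  induction n with
  | zero => intro x; exact runMax_nonneg T h 1 x
  | succ n ih =>
    intro x
    have := ih (T x)
    change max 0 (h x + runMax T h n (T x)) ≤ max 0 (h x + runMax T h (n + 1) (T x))
    gcongr

lemma birkhoffSum_le_runMax {α : Type*} (T : α → α) (h : α → ℝ) (n : ℕ) :
    ∀ x, birkhoffSum T h n x ≤ runMax T h n x := by
  induction n with
  | zero => intro x; simp [runMax]
  | succ n ih =>
    intro x
    rw [birkhoffSum_succ']
    exact (add_le_add_right (ih (T x)) _).trans (le_max_right _ _)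

lemma measurable_runMax {α : Type*} [MeasurableSpace α] {T : α → α} (hT : Measurable T)
    {h : α → ℝ} (hh : Measurable h) (n : ℕ) : Measurable (runMax T h n) := by
  induction n with
  | zero => exact measurable_const
  | succ n ih => exact measurable_const.max (hh.add (ih.comp hT))

lemma integrable_runMax {α : Type*} [MeasurableSpace α] {μ : Measure α} [IsFiniteMeasure μ]
    {T : α → α} (hT : MeasurePreserving T μ μ)
    {h : α → ℝ} (hh : Integrable h μ) (n : ℕ) : Integrable (runMax T h n) μ := by
  induction n with
  | zero => exact integrable_const _
  | succ n ih =>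
    exact (integrable_const (0 : ℝ)).sup (hh.add (hT.integrable_comp_of_integrable ih))

/-- The set where the running maxima are unbounded. -/
def blowSet {α : Type*} (T : α → α) (h : α → ℝ) : Set α :=
  {x | ∀ k : ℕ, ∃ n, (k : ℝ) < runMax T h n x}

lemma measurableSet_blowSet {α : Type*} [MeasurableSpace α] {T : α → α} (hT : Measurable T)
    {h : α → ℝ} (hh : Measurable h) : MeasurableSet (blowSet T h) := by
  have : blowSet T h = ⋂ k : ℕ, ⋃ n, {x | (k : ℝ) < runMax T h n x} := by
    ext x; simp [blowSet]
  rw [this]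
  exact MeasurableSet.iInter fun k => MeasurableSet.iUnion fun n =>
    measurableSet_lt measurable_const (measurable_runMax hT hh n)

lemma preimage_blowSet {α : Type*} (T : α → α) (h : α → ℝ) :
    T ⁻¹' (blowSet T h) = blowSet T h := by
  ext x
  simp only [blowSet, Set.mem_preimage, Set.mem_ofPred_eq]
  constructor
  · intro H k
    obtain ⟨m, hm⟩ := exists_nat_gt ((k : ℝ) - h x)
    obtain ⟨n, hn⟩ := H m
    exact ⟨n + 1, lt_of_lt_of_le (by linarith) (le_max_right _ _)⟩
  · intro H k
    obtain ⟨m, hm⟩ := exists_nat_gt ((k : ℝ) + h x)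
    obtain ⟨n, hn⟩ := H (max m 0)
    cases n with
    | zero =>
      simp only [runMax] at hn
      exact absurd hn (not_lt.2 (by positivity))
    | succ n =>
      refine ⟨n, ?_⟩
      have hn' : (m : ℝ) < max 0 (h x + runMax T h n (T x)) := by
        rw [Nat.max_zero] at hn
        exact hn
      rcases lt_max_iff.1 hn' with h0 | h0
      · exact absurd h0 (not_lt.2 (by positivity))
      · linarith

lemma setIntegral_blowSet_nonneg {α : Type*} [MeasurableSpace α] {μ : Measure α}
    [IsFiniteMeasure μ] {T : α → α} (hT : MeasurePreserving T μ μ)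
    {h : α → ℝ} (hm : Measurable h) (hh : Integrable h μ) :
    0 ≤ ∫ x in blowSet T h, h x ∂μ := by
  set G := blowSet T h with hG
  have hGm : MeasurableSet G := measurableSet_blowSet hT.measurable hm
  have hGT : T ⁻¹' G = G := preimage_blowSet T h
  have hmono : ∀ x, Monotone fun n => runMax T h n x :=
    fun x => monotone_nat_of_le_succ fun n => runMax_mono T h n x
  have hlim : Tendsto (fun n => ∫ x in G, (runMax T h (n + 1) x - runMax T h n (T x)) ∂μ) atTop
      (nhds (∫ x in G, h x ∂μ)) := by
    apply tendsto_integral_of_dominated_convergence (fun x => |h x|)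
    · intro n
      exact ((measurable_runMax hT.measurable hm _).sub
        ((measurable_runMax hT.measurable hm _).comp hT.measurable)).aestronglyMeasurable
    · exact hh.abs.integrableOn
    · intro n
      refine Eventually.of_forall fun x => ?_
      have h0 := runMax_nonneg T h n (T x)
      change |max 0 (h x + runMax T h n (T x)) - runMax T h n (T x)| ≤ |h x|
      rcases le_total 0 (h x) with h1 | h1
      · rw [max_eq_right (by linarith)]; simp
      · rw [abs_of_nonpos h1, abs_le]
        rcases max_cases 0 (h x + runMax T h n (T x)) with ⟨h2, h3⟩ | ⟨h2, h3⟩ <;>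
          rw [h2] <;> constructor <;> linarith
    · refine (ae_restrict_iff' hGm).2 (Eventually.of_forall fun x hx => ?_)
      have hx' : T x ∈ G := by rw [← hGT] at hx; exact hx
      obtain ⟨k, hk⟩ := exists_nat_gt (- h x)
      obtain ⟨N, hN⟩ := hx' k
      refine tendsto_const_nhds.congr' ?_
      filter_upwards [eventually_ge_atTop N] with n hn
      have := hmono (T x) hn
      change h x = max 0 (h x + runMax T h n (T x)) - runMax T h n (T x)
      simp only at this
      rw [max_eq_right (by linarith)]; ring
  refine ge_of_tendsto' hlim fun n => ?_
  have e1 : ∫ x in G, runMax T h n (T x) ∂μ = ∫ x in G, runMax T h n x ∂μ := by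
    conv_lhs => rw [← hGT]
    rw [← setIntegral_map hGm (by
      rw [hT.map_eq]
      exact (measurable_runMax hT.measurable hm n).aestronglyMeasurable) hT.aemeasurable,
      hT.map_eq]
  have i2 : IntegrableOn (fun x => runMax T h n (T x)) G μ :=
    (hT.integrable_comp_of_integrable (integrable_runMax hT hh n)).integrableOn
  rw [integral_sub (integrable_runMax hT hh _).integrableOn i2, e1, sub_nonneg]
  exact integral_mono (integrable_runMax hT hh _).integrableOn
    (integrable_runMax hT hh _).integrableOn (runMax_mono T h n)

lemma birkhoff_upper {α : Type*} [MeasurableSpace α] {μ : Measure α}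
    [IsProbabilityMeasure μ] {T : α → α} (hT : MeasurePreserving T μ μ)
    {f g : α → ℝ} (hf : Measurable f) (hfi : Integrable f μ)
    (hg : Measurable[MeasurableSpace.invariants T] g) (hgi : Integrable g μ)
    (hfg : ∀ s, MeasurableSet[MeasurableSpace.invariants T] s →
      ∫ x in s, g x ∂μ = ∫ x in s, f x ∂μ) {ε : ℝ} (hε : 0 < ε) :
    ∀ᵐ x ∂μ, ∃ K : ℝ, ∀ n, birkhoffSum T f n x ≤ n * (g x + ε) + K := by
  have hgm : Measurable g := hg.mono (MeasurableSpace.invariants_le T) le_rfl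
  have hgT : g ∘ T = g := MeasurableSpace.comp_eq_of_measurable_invariants hg
  let h : α → ℝ := fun x => f x - (g x + ε)
  have hm : Measurable h := hf.sub (hgm.add_const _)
  have hi : Integrable h μ := hfi.sub (hgi.add (integrable_const _))
  have h0 := setIntegral_blowSet_nonneg hT hm hi
  have hGm := measurableSet_blowSet hT.measurable hm
  have h1 : ∫ x in blowSet T h, h x ∂μ = - (ε * μ.real (blowSet T h)) := by
    have : ∫ x in blowSet T h, h x ∂μ = ∫ x in blowSet T h, f x ∂μ -
        (∫ x in blowSet T h, g x ∂μ + ∫ x in blowSet T h, ε ∂μ) := by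
      rw [← integral_add hgi.integrableOn (integrable_const _), ← integral_sub hfi.integrableOn]
      exact (hgi.add (integrable_const _)).integrableOn
    rw [this, hfg _ ⟨hGm, preimage_blowSet T h⟩]
    simp [mul_comm]
  have h2 : μ.real (blowSet T h) = 0 := by
    have h3 : (0 : ℝ) ≤ μ.real (blowSet T h) := measureReal_nonneg
    nlinarith
  have h4 : μ (blowSet T h) = 0 := by
    rwa [measureReal_eq_zero_iff] at h2
  filter_upwards [measure_eq_zero_iff_ae_notMem.1 h4] with x hx
  simp only [blowSet, Set.mem_ofPred_eq, not_forall, not_exists, not_lt] at hx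
  obtain ⟨k, hk⟩ := hx
  refine ⟨k, fun n => ?_⟩
  have h5 := (birkhoffSum_le_runMax T h n x).trans (hk n)
  have h6 : birkhoffSum T h n x = birkhoffSum T f n x - n * (g x + ε) := by
    have : (fun x => g x + ε) ∘ T = fun x => g x + ε := by
      funext x; simpa using congrFun hgT x
    have h7 := congrFun (birkhoffSum_of_comp_eq this n) x
    have h8 := birkhoffSum_sub T f (fun x => g x + ε) n x
    simp only [Pi.smul_apply, nsmul_eq_mul] at h7
    rw [← h7, ← h8]; rfl
  linarith

lemma birkhoff_ergodic {α : Type*} [MeasurableSpace α] {μ : Measure α}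
    [IsProbabilityMeasure μ] {T : α → α} (hT : MeasurePreserving T μ μ)
    {f g : α → ℝ} (hf : Measurable f) (hfi : Integrable f μ)
    (hg : Measurable[MeasurableSpace.invariants T] g) (hgi : Integrable g μ)
    (hfg : ∀ s, MeasurableSet[MeasurableSpace.invariants T] s →
      ∫ x in s, g x ∂μ = ∫ x in s, f x ∂μ) :
    ∀ᵐ x ∂μ, Tendsto (fun n : ℕ => (n : ℝ)⁻¹ * birkhoffSum T f n x) atTop (nhds (g x)) := by
  have H1 : ∀ᵐ x ∂μ, ∀ k : ℕ, ∃ K : ℝ, ∀ n,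
      birkhoffSum T f n x ≤ n * (g x + 1 / ((k : ℝ) + 1)) + K :=
    ae_all_iff.2 fun k => birkhoff_upper hT hf hfi hg hgi hfg (by positivity)
  have H2 : ∀ᵐ x ∂μ, ∀ k : ℕ, ∃ K : ℝ, ∀ n,
      birkhoffSum T (-f) n x ≤ n * ((-g) x + 1 / ((k : ℝ) + 1)) + K :=
    ae_all_iff.2 fun k => birkhoff_upper hT hf.neg hfi.neg (@Measurable.neg _ _ _ _ _ (_) _ hg) hgi.neg
      (fun s hs => by simp [integral_neg, hfg s hs]) (by positivity)
  filter_upwards [H1, H2] with x h1 h2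
  rw [Metric.tendsto_atTop']
  intro ε hε
  obtain ⟨k, hk⟩ := exists_nat_one_div_lt (half_pos hε)
  obtain ⟨K1, hK1⟩ := h1 k
  obtain ⟨K2, hK2⟩ := h2 k
  obtain ⟨N, hN⟩ := exists_nat_gt ((|K1| + |K2|) / (ε / 2))
  refine ⟨N, fun n hn => ?_⟩
  have hn0 : (0 : ℝ) < n := by exact_mod_cast (Nat.zero_le N).trans_lt hn
  have hnN : (N : ℝ) < n := by exact_mod_cast hn
  have h3 : |K1| + |K2| < n * (ε / 2) := by
    rw [div_lt_iff₀ (by positivity)] at hN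
    nlinarith
  have a1 := hK1 n
  have a2 := hK2 n
  have h9 : birkhoffSum T (-f) n x = - birkhoffSum T f n x := birkhoffSum_neg T f n x
  rw [h9, Pi.neg_apply] at a2
  have b1 := le_abs_self K1
  have b2 := le_abs_self K2
  have b3 := abs_nonneg K1
  have b4 := abs_nonneg K2
  have c1 : (n : ℝ) * (1 / ((k : ℝ) + 1)) < n * (ε / 2) := by gcongr
  rw [Real.dist_eq, show (n : ℝ)⁻¹ * birkhoffSum T f n x - g x
    = (birkhoffSum T f n x - n * g x) / n by field_simp, abs_div, abs_of_pos hn0,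
    div_lt_iff₀ hn0, abs_lt]
  constructor <;> nlinarith

lemma env_deterministic (l β : ℕ → ℝ) (hl : ∀ i, 0 ≤ l i) (hβ : ∀ i, 0 ≤ β i)
    (hlim : atTop.limsup (fun n : ℕ => (∏ i ∈ Finset.range n, l i) ^ ((n : ℝ)⁻¹)) < 1)
    (hbdd : ∃ K : ℝ, ∀ n : ℕ, (∏ i ∈ Finset.range n, l i) ^ ((n : ℝ)⁻¹) ≤ K)
    (hb : ∀ k : ℕ, ∀ᶠ n : ℕ in atTop, β n ≤ Real.exp (n / ((k : ℝ) + 1))) :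
    ∃ C : ℕ, 0 < C ∧ (∀ j : ℕ, C ≤ j → ∏ i ∈ Finset.range j, l i ≤ 1 - 1 / (C : ℝ)) ∧
      ENNReal.ofReal (β 0) +
        ∑' m : ℕ, (∏ k ∈ Finset.range (m + 1), ENNReal.ofReal (l k)) *
          ENNReal.ofReal (β (m + 1)) ≤ (C : ℝ≥0∞) := by
  obtain ⟨K, hK⟩ := hbdd
  obtain ⟨r, hr0, hr1⟩ := exists_between (max_lt hlim one_pos)
  have hr : 0 < r := (le_max_right _ _).trans_lt hr0
  have hev : ∀ᶠ n : ℕ in atTop, (∏ i ∈ Finset.range n, l i) ^ ((n : ℝ)⁻¹) < r :=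
    eventually_lt_of_limsup_lt ((le_max_left _ _).trans_lt hr0)
      ⟨K, eventually_map.2 (Eventually.of_forall hK)⟩
  have hp0 : ∀ n, 0 ≤ ∏ i ∈ Finset.range n, l i := fun n => Finset.prod_nonneg fun i _ => hl i
  have hprod : ∀ᶠ n : ℕ in atTop, ∏ i ∈ Finset.range n, l i ≤ r ^ n := by
    filter_upwards [hev, eventually_gt_atTop 0] with n hn hn0
    have := pow_le_pow_left₀ (Real.rpow_nonneg (hp0 n) _) hn.le n
    rwa [Real.rpow_inv_natCast_pow (hp0 n) hn0.ne'] at this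
  have hp : Tendsto (fun n => ∏ i ∈ Finset.range n, l i) atTop (nhds 0) :=
    squeeze_zero' (Eventually.of_forall hp0) hprod (tendsto_pow_atTop_nhds_zero_of_lt_one hr.le hr1)
  have hexp : Tendsto (fun k : ℕ => r * Real.exp (1 / ((k : ℝ) + 1))) atTop (nhds (r * Real.exp 0)) :=
    ((Real.continuous_exp.tendsto 0).comp tendsto_one_div_add_atTop_nhds_zero_nat).const_mul r
  rw [Real.exp_zero, mul_one] at hexp
  obtain ⟨k, hk⟩ := (hexp.eventually_lt_const hr1).exists
  set q := r * Real.exp (1 / ((k : ℝ) + 1)) with hq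
  have hq0 : 0 ≤ q := by positivity
  have hsum : Summable fun n : ℕ => (∏ i ∈ Finset.range n, l i) * β n := by
    refine (summable_geometric_of_lt_one hq0 hk).of_norm_bounded_eventually_nat ?_
    filter_upwards [hprod, hb k] with n h1 h2
    rw [Real.norm_of_nonneg (mul_nonneg (hp0 n) (hβ n)), hq, mul_pow, ← Real.exp_nat_mul]
    have : (n : ℝ) * (1 / ((k : ℝ) + 1)) = n / ((k : ℝ) + 1) := by ring
    rw [this]
    exact mul_le_mul h1 h2 (hβ n) (by positivity)
  have hsum' := (summable_nat_add_iff 1).2 hsum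
  have hfin : ENNReal.ofReal (β 0) +
        ∑' m : ℕ, (∏ k ∈ Finset.range (m + 1), ENNReal.ofReal (l k)) *
          ENNReal.ofReal (β (m + 1)) ≠ ∞ := by
    refine ENNReal.add_ne_top.2 ⟨ENNReal.ofReal_ne_top, ?_⟩
    have := hsum'.tsum_ofReal_ne_top
    convert! this using 4 with m
    rw [ENNReal.ofReal_mul (hp0 _), ENNReal.ofReal_prod_of_nonneg fun i _ => hl i]
  obtain ⟨N1, hN1⟩ := ENNReal.exists_nat_gt hfin
  obtain ⟨N2, hN2⟩ := eventually_atTop.1 (hp.eventually_lt_const (by norm_num : (0 : ℝ) < 1 / 2))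
  refine ⟨max (max N1 N2) 2, by positivity, fun j hj => ?_, hN1.le.trans ?_⟩
  · have h1 := hN2 j (le_trans (le_trans (le_max_right _ _) (le_max_left _ _)) hj)
    have h2 : (2 : ℝ) ≤ (max (max N1 N2) 2 : ℕ) := by exact_mod_cast le_max_right _ _
    have h3 : 1 / ((max (max N1 N2) 2 : ℕ) : ℝ) ≤ 1 / 2 :=
      one_div_le_one_div_of_le (by norm_num) h2
    linarith
  · exact_mod_cast le_trans (le_max_left _ _) (le_max_left _ _)

lemma prod_rpow_le (l : ℕ → ℝ) (hl : ∀ i, 0 ≤ l i) (n : ℕ) :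
    (∏ i ∈ Finset.range n, l i) ^ ((n : ℝ)⁻¹) ≤
      Real.exp ((n : ℝ)⁻¹ * ∑ i ∈ Finset.range n, Real.log (max (l i) 1)) := by
  rw [mul_comm, Real.exp_mul, Real.exp_sum]
  refine Real.rpow_le_rpow (Finset.prod_nonneg fun i _ => hl i) ?_ (by positivity)
  refine Finset.prod_le_prod (fun i _ => hl i) fun i _ => ?_
  rw [Real.exp_log (by positivity)]
  exact le_max_left _ _

/-- The inverse shift. -/
def zback {α : Type*} (x : ℤ → α) : ℤ → α := fun t => x (t - 1)

lemma zshift_iterate {α : Type*} (n : ℕ) (x : ℤ → α) :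
    zshift^[n] x = fun t => x (t + n) := by
  induction n generalizing x with
  | zero => simp
  | succ n ih =>
    rw [Function.iterate_succ_apply, ih]
    funext t
    simp only [zshift]
    congr 1; push_cast; ring

lemma zback_iterate {α : Type*} (n : ℕ) (x : ℤ → α) :
    zback^[n] x = fun t => x (t - n) := by
  induction n generalizing x with
  | zero => simp
  | succ n ih =>
    rw [Function.iterate_succ_apply, ih]
    funext t
    simp only [zback]
    congr 1; push_cast; ring

lemma zback_zshift {α : Type*} (x : ℤ → α) : zback (zshift x) = x := by
  funext t; simp [zback, zshift]

lemma zshift_zback {α : Type*} (x : ℤ → α) : zshift (zback x) = x := by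
  funext t; simp [zback, zshift]

lemma measurable_zshift {F : Type*} [MeasurableSpace F] :
    Measurable (zshift : (ℤ → F) → (ℤ → F)) :=
  measurable_pi_lambda _ fun t => measurable_pi_apply _

lemma measurable_zback {F : Type*} [MeasurableSpace F] :
    Measurable (zback : (ℤ → F) → (ℤ → F)) :=
  measurable_pi_lambda _ fun t => measurable_pi_apply _

lemma invSigma_eq (F : Type*) [MeasurableSpace F] :
    invSigma F = MeasurableSpace.invariants (zshift : (ℤ → F) → (ℤ → F)) :=
  MeasurableSpace.ext fun _ => Iff.rfl

lemma invSigma_eq_back (F : Type*) [MeasurableSpace F] :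
    invSigma F = MeasurableSpace.invariants (zback : (ℤ → F) → (ℤ → F)) := by
  refine MeasurableSpace.ext fun s => and_congr_right fun _ => ?_
  constructor
  · intro h
    conv_lhs => rw [← h]
    ext x; simp [zshift_zback]
  · intro h
    conv_lhs => rw [← h]
    ext x; simp [zback_zshift]

lemma measurableSet_goodSet {F : Type*} [MeasurableSpace F] {lam b : F → ℝ} {η : ℝ → F → ℝ}
    (hlam : Measurable lam) (hb : Measurable b)
    (hη : Measurable fun p : ℝ × F => η p.1 p.2) (C : ℕ × ℕ) :
    MeasurableSet (goodSet lam b η C) := by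
  have m1 : ∀ j : ℕ, Measurable fun x : ℕ → F => ∏ i ∈ Finset.range j, lam (x (i + 1)) :=
    fun j => Finset.measurable_prod _ fun i _ => hlam.comp (measurable_pi_apply _)
  have m2 : Measurable fun x : ℕ → F => ENNReal.ofReal (b (x 1)) +
        ∑' m : ℕ, (∏ k ∈ Finset.range (m + 1), ENNReal.ofReal (lam (x (k + 1)))) *
          ENNReal.ofReal (b (x (m + 2))) := by
    refine ((hb.comp (measurable_pi_apply _)).ennreal_ofReal).add (Measurable.ennreal_tsum fun m => ?_)
    exact (Finset.measurable_prod _ fun i _ =>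
      (hlam.comp (measurable_pi_apply _)).ennreal_ofReal).mul
        (hb.comp (measurable_pi_apply _)).ennreal_ofReal
  have m3 : ∀ R : ℝ, Measurable fun x : ℕ → F => η R (x 0) := fun R =>
    hη.comp (measurable_const.prodMk (measurable_pi_apply 0))
  have s1 : MeasurableSet {x : ℕ → F | ∀ j : ℕ, C.1 ≤ j →
      ∏ i ∈ Finset.range j, lam (x (i + 1)) ≤ 1 - 1 / (C.1 : ℝ)} := by
    have : {x : ℕ → F | ∀ j : ℕ, C.1 ≤ j →
      ∏ i ∈ Finset.range j, lam (x (i + 1)) ≤ 1 - 1 / (C.1 : ℝ)} = ⋂ j : ℕ, ⋂ _ : C.1 ≤ j,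
        {x : ℕ → F | ∏ i ∈ Finset.range j, lam (x (i + 1)) ≤ 1 - 1 / (C.1 : ℝ)} := by
      ext x; simp
    rw [this]
    exact MeasurableSet.iInter fun j => MeasurableSet.iInter fun _ =>
      measurableSet_le (m1 j) measurable_const
  exact s1.inter ((measurableSet_le m2 measurable_const).inter
    (measurableSet_le measurable_const (m3 _)))

lemma ae_exp_bound {α : Type*} [MeasurableSpace α] {μ : Measure α} [IsProbabilityMeasure μ]
    {T : α → α} (hT : MeasurePreserving T μ μ) {u : α → ℝ} (hu : Measurable u)
    (hu0 : ∀ x, 0 ≤ u x) (hui : Integrable u μ) :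
    ∀ᵐ x ∂μ, ∀ k : ℕ, ∀ᶠ n : ℕ in atTop, u (T^[n] x) ≤ n / ((k : ℝ) + 1) := by
  refine ae_all_iff.2 fun k => ?_
  have hk : (0 : ℝ) < (k : ℝ) + 1 := by positivity
  letI : MeasureSpace α := ⟨μ⟩
  haveI : IsProbabilityMeasure (volume : Measure α) := inferInstanceAs (IsProbabilityMeasure μ)
  have h1 : (∑' j : ℕ, μ {x | u x * ((k : ℝ) + 1) ∈ Set.Ioi (j : ℝ)}) < ∞ :=
    tsum_prob_mem_Ioi_lt_top (Ω := α) (X := fun x => u x * ((k : ℝ) + 1))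
      (hui.mul_const _) (fun x => mul_nonneg (hu0 x) hk.le)
  have h2 : ∀ j : ℕ, μ {x | u (T^[j] x) * ((k : ℝ) + 1) ∈ Set.Ioi (j : ℝ)} =
      μ {x | u x * ((k : ℝ) + 1) ∈ Set.Ioi (j : ℝ)} := fun j =>
    (hT.iterate j).measure_preimage (((hu.mul_const _) measurableSet_Ioi).nullMeasurableSet)
  simp_rw [← h2] at h1
  filter_upwards [ae_eventually_notMem h1.ne] with x hx
  filter_upwards [hx] with n hn
  simp only [Set.mem_ofPred_eq, Set.mem_Ioi, not_lt] at hn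
  rwa [le_div_iff₀ hk]

theorem good_environment_frequencies
    {E F : Type*}
    [MeasurableSpace E] [TopologicalSpace E] [PolishSpace E] [BorelSpace E]
    [MeasurableSpace F] [TopologicalSpace F] [PolishSpace F] [BorelSpace F]
    {Ω : Type*} [MeasurableSpace Ω] (Pr : Measure Ω) [IsProbabilityMeasure Pr]
    (X : ℤ → Ω → F) (hX : ∀ t, Measurable (X t))
    (P : Kernel (F × E) E) [IsMarkovKernel P]
    -- A1 : the environment is stationary
    (hstat : (Pr.map fun ω => fun t => X t ω).map zshift = Pr.map fun ω => fun t => X t ω)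
    -- A2 : drift condition with random coefficients
    (V : E → ℝ) (hVmeas : Measurable V) (hVpos : ∀ y, 0 < V y)
    (lam b : F → ℝ) (hlam : Measurable lam) (hb : Measurable b)
    (hlam0 : ∀ x, 0 ≤ lam x) (hb0 : ∀ x, 0 ≤ b x)
    (hlamlog : ∫⁻ ω, ENNReal.ofReal (Real.log (max (lam (X 0 ω)) 1)) ∂Pr < ∞)
    (hblog : ∫⁻ ω, ENNReal.ofReal (Real.log (max (b (X 0 ω)) 1)) ∂Pr < ∞)
    (hdrift : ∀ (x : F) (y : E), ∫⁻ z, ENNReal.ofReal (V z) ∂(P (x, y)) ≤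
      ENNReal.ofReal (lam x) * ENNReal.ofReal (V y) + ENNReal.ofReal (b x))
    (hlyap : ∀ᵐ ω ∂Pr, atTop.limsup
      (fun n : ℕ => (∏ i ∈ Finset.range n, lam (X (-(i : ℤ) - 1) ω)) ^ ((n : ℝ)⁻¹)) < 1)
    -- A3 : sublevel sets of V are small sets, uniformly in the environment
    (η : ℝ → F → ℝ) (hηmeas : Measurable fun p : ℝ × F => η p.1 p.2)
    (hη01 : ∀ R > (0 : ℝ), ∀ x, η R x ∈ Set.Ioo (0 : ℝ) 1)
    (hsmall : ∀ R > (0 : ℝ), ∃ ν : Kernel F E, IsMarkovKernel ν ∧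
      ∀ (x : F) (y : E) (A : Set E), MeasurableSet A → V y ≤ R →
        ENNReal.ofReal (η R x) * ν x A ≤ P (x, y) A) :
    -- there is a version `rho c` of `ℙ(ξ₀ ∈ A_c | X⁻¹(𝓘))` for every pair `c`, and a random
    -- pair `C` of positive integers such that a.s. the empirical frequencies of the events
    -- `{ξ_i ∈ A_C}` (and `{ξ_{-i} ∈ A_C}`) converge to `ρ_C > 0`.
    ∃ rho : ℕ × ℕ → Ω → ℝ,
      (∀ c : ℕ × ℕ, rho c =ᵐ[Pr]
        Pr[({ω : Ω | (fun j : ℕ => X (0 - (j : ℤ)) ω) ∈ goodSet lam b η c}).indicator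
            (fun _ => (1 : ℝ)) |
          MeasurableSpace.comap (fun ω => fun t => X t ω) (invSigma F)]) ∧
      ∃ C : Ω → ℕ × ℕ, Measurable C ∧
        ∀ᵐ ω ∂Pr,
          0 < (C ω).1 ∧ 0 < (C ω).2 ∧ 0 < rho (C ω) ω ∧
          Tendsto (fun n : ℕ => (1 / (n : ℝ)) * ∑ i ∈ Finset.range (n + 1),
              (goodSet lam b η (C ω)).indicator (fun _ => (1 : ℝ))
                (fun j : ℕ => X ((i : ℤ) - (j : ℤ)) ω))
            atTop (nhds (rho (C ω) ω)) ∧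
          Tendsto (fun n : ℕ => (1 / (n : ℝ)) * ∑ i ∈ Finset.range n,
              (goodSet lam b η (C ω)).indicator (fun _ => (1 : ℝ))
                (fun j : ℕ => X (-(i : ℤ) - 1 - (j : ℤ)) ω))
            atTop (nhds (rho (C ω) ω)) := by
  classical
  set π : Ω → (ℤ → F) := fun ω => fun t => X t ω with hπdef
  have hπ : Measurable π := measurable_pi_lambda _ hX
  set μ : Measure (ℤ → F) := Pr.map π with hμ
  have hμp : IsProbabilityMeasure μ := Measure.isProbabilityMeasure_map hπ.aemeasurable
  have hT : MeasurePreserving (zshift : (ℤ → F) → (ℤ → F)) μ μ := ⟨measurable_zshift, hstat⟩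
  have hB : MeasurePreserving (zback : (ℤ → F) → (ℤ → F)) μ μ := by
    refine ⟨measurable_zback, ?_⟩
    conv_lhs => rw [← hstat]
    rw [Measure.map_map measurable_zback measurable_zshift]
    have : (zback : (ℤ → F) → (ℤ → F)) ∘ zshift = id := funext zback_zshift
    rw [this, Measure.map_id]
  have hle : invSigma F ≤ MeasurableSpace.pi := fun s hs => hs.1
  let f : ℕ × ℕ → (ℤ → F) → ℝ := fun c x =>
    (goodSet lam b η c).indicator (fun _ => (1 : ℝ)) (fun j : ℕ => x (0 - (j : ℤ)))
  have hfm : ∀ c, Measurable (f c) := fun c =>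
    (measurable_const.indicator (measurableSet_goodSet hlam hb hηmeas c)).comp
      (measurable_pi_lambda _ fun _ => measurable_pi_apply _)
  have hf0 : ∀ c x, 0 ≤ f c x := fun c x => Set.indicator_nonneg (fun _ _ => zero_le_one) _
  have hf1 : ∀ c x, f c x ≤ 1 := fun c x => Set.indicator_le_self' (fun _ _ => zero_le_one) _
  have hfi : ∀ c, Integrable (f c) μ := fun c =>
    Integrable.of_bound (hfm c).aestronglyMeasurable 1 (Eventually.of_forall fun x => by
      rw [Real.norm_of_nonneg (hf0 c x)]; exact hf1 c x)
  let g : ℕ × ℕ → (ℤ → F) → ℝ := fun c => μ[f c | invSigma F]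
  have hgI : ∀ c, Measurable[invSigma F] (g c) := fun c => stronglyMeasurable_condExp.measurable
  have hgm : ∀ c, Measurable (g c) := fun c => (hgI c).mono hle le_rfl
  have hgi : ∀ c, Integrable (g c) μ := fun c => integrable_condExp
  have hfg : ∀ c s, MeasurableSet[invSigma F] s → ∫ x in s, g c x ∂μ = ∫ x in s, f c x ∂μ :=
    fun c s hs => setIntegral_condExp hle (hfi c) hs
  -- ergodic theorem, forward and backward
  have hfwd : ∀ c, ∀ᵐ x ∂μ, Tendsto (fun n : ℕ => (n : ℝ)⁻¹ * birkhoffSum zshift (f c) n x)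
      atTop (nhds (g c x)) := fun c =>
    birkhoff_ergodic hT (hfm c) (hfi c) (invSigma_eq F ▸ hgI c) (hgi c)
      (by rw [← invSigma_eq F]; exact hfg c)
  have hbwd : ∀ c, ∀ᵐ x ∂μ, Tendsto (fun n : ℕ => (n : ℝ)⁻¹ * birkhoffSum zback (f c) n x)
      atTop (nhds (g c x)) := fun c =>
    birkhoff_ergodic hB (hfm c) (hfi c) (invSigma_eq_back F ▸ hgI c) (hgi c)
      (by rw [← invSigma_eq_back F]; exact hfg c)
  have hgB : ∀ c x, g c (zback x) = g c x := fun c x =>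
    congrFun (MeasurableSpace.comp_eq_of_measurable_invariants (invSigma_eq_back F ▸ hgI c :
      Measurable[MeasurableSpace.invariants zback] (g c))) x
  -- boundedness of the geometric means
  have hlogInt : ∀ v : F → ℝ, Measurable v → ∫⁻ ω, ENNReal.ofReal (Real.log (max (v (X 0 ω)) 1)) ∂Pr < ∞ →
      Measurable (fun x : ℤ → F => Real.log (max (v (x 0)) 1)) ∧
      Integrable (fun x : ℤ → F => Real.log (max (v (x 0)) 1)) μ := by
    intro v hv hvi
    have hm : Measurable (fun x : ℤ → F => Real.log (max (v (x 0)) 1)) :=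
      ((hv.comp (measurable_pi_apply 0)).max measurable_const).log
    refine ⟨hm, ⟨hm.aestronglyMeasurable, ?_⟩⟩
    rw [hasFiniteIntegral_iff_ofReal (Eventually.of_forall fun x => Real.log_nonneg (le_max_right _ _)),
      hμ, lintegral_map hm.ennreal_ofReal hπ]
    exact hvi
  obtain ⟨hLm, hLi⟩ := hlogInt lam hlam hlamlog
  obtain ⟨hbm, hbi⟩ := hlogInt b hb hblog
  have hbddμ : ∀ᵐ x ∂μ, Tendsto (fun n : ℕ => (n : ℝ)⁻¹ * birkhoffSum zback
      (fun x : ℤ → F => Real.log (max (lam (x 0)) 1)) n (zback x))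
      atTop (nhds ((μ[(fun x : ℤ → F => Real.log (max (lam (x 0)) 1)) | invSigma F]) (zback x))) :=
    hB.quasiMeasurePreserving.ae (birkhoff_ergodic hB hLm hLi
      (by rw [← invSigma_eq_back F]; exact stronglyMeasurable_condExp.measurable) integrable_condExp
      (by rw [← invSigma_eq_back F]; exact fun s hs => setIntegral_condExp hle hLi hs))
  have hexpμ : ∀ᵐ x ∂μ, ∀ k : ℕ, ∀ᶠ n : ℕ in atTop,
      Real.log (max (b ((zback^[n] (zback x)) 0)) 1) ≤ n / ((k : ℝ) + 1) :=
    hB.quasiMeasurePreserving.ae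
      (ae_exp_bound hB hbm (fun x => Real.log_nonneg (le_max_right _ _)) hbi)
  have hiter : ∀ (x : ℤ → F) (n : ℕ), (zback^[n] (zback x)) 0 = x (-(n : ℤ) - 1) := by
    intro x n
    rw [zback_iterate]; simp [zback]
  have hgood : ∀ᵐ ω ∂Pr, ∃ c : ℕ × ℕ, 0 < c.1 ∧ 0 < c.2 ∧
      (fun j : ℕ => X (0 - (j : ℤ)) ω) ∈ goodSet lam b η c := by
    filter_upwards [hlyap, ae_of_ae_map hπ.aemeasurable hbddμ,
      ae_of_ae_map hπ.aemeasurable hexpμ] with ω h1 h2 h3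
    have hidx : ∀ i : ℕ, (0 : ℤ) - ((i + 1 : ℕ) : ℤ) = -(i : ℤ) - 1 := fun i => by push_cast; ring
    obtain ⟨C1, hC1, hA, hS⟩ := env_deterministic
      (fun i => lam (X (-(i : ℤ) - 1) ω)) (fun i => b (X (-(i : ℤ) - 1) ω))
      (fun i => hlam0 _) (fun i => hb0 _) h1 (by
        obtain ⟨K, hK⟩ := h2.bddAbove_range
        refine ⟨Real.exp K, fun n => (prod_rpow_le _ (fun i => hlam0 _) n).trans
          (Real.exp_le_exp.2 ?_)⟩
        have := hK ⟨n, rfl⟩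
        simpa only [birkhoffSum, hiter] using this) (by
        intro k
        filter_upwards [h3 k] with n hn
        rw [hiter] at hn
        exact (le_max_left _ 1).trans ((Real.log_le_iff_le_exp (by positivity)).1 hn))
    have hR : (0 : ℝ) < 2 * (C1 : ℝ) * (2 * (C1 : ℝ) + 1) := by positivity
    obtain ⟨m, hm⟩ := exists_nat_one_div_lt (hη01 _ hR (X 0 ω)).1
    refine ⟨(C1, m + 1), hC1, Nat.succ_pos _, ?_, ?_, ?_⟩
    · intro j hj
      simpa only [hidx] using hA j hj
    · have e : ∀ m : ℕ, (0 : ℤ) - ((m + 2 : ℕ) : ℤ) = -((m + 1 : ℕ) : ℤ) - 1 :=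
        fun m => by push_cast; ring
      have e1 : (0 : ℤ) - ((1 : ℕ) : ℤ) = -((0 : ℕ) : ℤ) - 1 := by norm_num
      simpa only [hidx, e, e1] using hS
    · refine le_trans ?_ (le_of_lt hm)
      push_cast
      exact one_div_le_one_div_of_le (by positivity) (by linarith)
  -- positivity
  let cc : ℕ → ℕ × ℕ := fun k => ((Nat.unpair k).1 + 1, (Nat.unpair k).2 + 1)
  let N : Set (ℤ → F) := {x | ∀ k, g (cc k) x ≤ 0}
  have hN : MeasurableSet[invSigma F] N := by
    have : N = ⋂ k, g (cc k) ⁻¹' Set.Iic 0 := by ext x; simp [N]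
    rw [this]
    exact MeasurableSet.iInter fun k => hgI _ measurableSet_Iic
  have hNz : ∀ᵐ x ∂μ, ∀ k, x ∈ N → f (cc k) x = 0 := by
    refine ae_all_iff.2 fun k => ?_
    have h1 : ∫ x in N, f (cc k) x ∂μ ≤ 0 := by
      rw [← hfg _ _ hN]
      exact setIntegral_nonpos (hle _ hN) fun x hx => hx k
    have h2 : ∫ x in N, f (cc k) x ∂μ = 0 := le_antisymm h1 (integral_nonneg fun x => hf0 _ _)
    rw [integral_eq_zero_iff_of_nonneg (fun x => hf0 _ _) (hfi _).integrableOn] at h2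
    exact (ae_restrict_iff' (hle _ hN)).1 h2
  have hpos : ∀ᵐ ω ∂Pr, ∃ k, 0 < g (cc k) (π ω) := by
    filter_upwards [hgood, ae_of_ae_map hπ.aemeasurable hNz] with ω ⟨c, hc1, hc2, hc⟩ h2
    by_contra hcon
    push Not at hcon
    have h3 := h2 (Nat.pair (c.1 - 1) (c.2 - 1)) hcon
    have h4 : cc (Nat.pair (c.1 - 1) (c.2 - 1)) = c := by
      ext <;> simp [cc] <;> omega
    rw [h4] at h3
    have h5 : f c (π ω) = 1 := Set.indicator_of_mem hc _
    rw [h5] at h3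
    exact one_ne_zero h3
  let p : Ω → ℕ → Prop := fun ω k => 0 < g (cc k) (π ω) ∨ ∀ m, g (cc m) (π ω) ≤ 0
  have hp : ∀ ω, ∃ k, p ω k := by
    intro ω
    by_cases h : ∃ k, 0 < g (cc k) (π ω)
    · exact h.imp fun k hk => Or.inl hk
    · push Not at h; exact ⟨0, Or.inr h⟩
  have hpm : ∀ k, MeasurableSet {ω | p ω k} := fun k =>
    (measurableSet_lt measurable_const ((hgm _).comp hπ)).union (hπ (hle _ hN))
  have hcomap : MeasurableSpace.comap π (invSigma F) ≤ ‹MeasurableSpace Ω› :=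
    (MeasurableSpace.comap_mono hle).trans hπ.comap_le
  refine ⟨fun c ω => g c (π ω), fun c => ?_, fun ω => cc (Nat.find (hp ω)),
    (measurable_from_top (f := cc)).comp (measurable_find hp hpm), ?_⟩
  · have hfπ : Integrable (fun ω => f c (π ω)) Pr := (hfi c).comp_measurable hπ
    have hgπ : Integrable (fun ω => g c (π ω)) Pr := (hgi c).comp_measurable hπ
    refine ae_eq_condExp_of_forall_setIntegral_eq hcomap hfπ (fun s _ _ => hgπ.integrableOn) ?_ ?_
    · rintro _ ⟨S, hS, rfl⟩ _
      have h1 := setIntegral_map (hle _ hS) (hgm c).aestronglyMeasurable hπ.aemeasurable (μ := Pr)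
      have h2 := setIntegral_map (hle _ hS) (hfm c).aestronglyMeasurable hπ.aemeasurable (μ := Pr)
      rw [← h1, hfg c S hS, h2]
      rfl
    · exact ((hgI c).comp (comap_measurable π)).stronglyMeasurable.aestronglyMeasurable
  · filter_upwards [hpos, ae_of_ae_map hπ.aemeasurable (ae_all_iff.2 hfwd),
      ae_of_ae_map hπ.aemeasurable (hB.quasiMeasurePreserving.ae (ae_all_iff.2 hbwd))]
      with ω ⟨k, hk⟩ h1 h2
    refine ⟨Nat.succ_pos _, Nat.succ_pos _, ?_, ?_, ?_⟩
    · rcases Nat.find_spec (hp ω) with h | h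
      · exact h
      · exact absurd hk (not_lt.2 (h k))
    · generalize cc (Nat.find (hp ω)) = c
      have h3 := (h1 c).comp (tendsto_add_atTop_nat 1)
      have h4 : Tendsto (fun n : ℕ => 1 + 1 / (n : ℝ)) atTop (nhds (1 + 0)) :=
        tendsto_const_nhds.add tendsto_one_div_atTop_nhds_zero_nat
      have h5 := h4.mul h3
      rw [add_zero, one_mul] at h5
      refine h5.congr' ?_
      filter_upwards [eventually_gt_atTop 0] with n hn
      have hn' : (n : ℝ) ≠ 0 := by positivity
      have hn1 : ((n + 1 : ℕ) : ℝ) ≠ 0 := by positivity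
      have e : birkhoffSum zshift (f c) (n + 1) (π ω) = ∑ i ∈ Finset.range (n + 1),
              (goodSet lam b η c).indicator (fun _ => (1 : ℝ))
                (fun j : ℕ => X ((i : ℤ) - (j : ℤ)) ω) := by
        refine Finset.sum_congr rfl fun i _ => ?_
        rw [zshift_iterate]
        simp only [f, π]
        congr 1; funext j; congr 1; ring
      rw [← e]
      simp only [Function.comp]
      rw [← mul_assoc]
      congr 1
      push_cast at hn1 ⊢
      field_simp
    · generalize cc (Nat.find (hp ω)) = c
      have h3 := h2 c
      rw [hgB] at h3
      refine h3.congr fun n => ?_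
      rw [one_div]
      congr 1
      refine Finset.sum_congr rfl fun i _ => ?_
      rw [zback_iterate]
      simp only [f, π, zback]
      congr 1; funext j; congr 1; ring

end
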